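/- arXiv:math/0505428 — 2 statements merged into one kernel-verified Lean document; each statement's English description precedes it below -/
import Mathlib

section
/- Spectral decomposition for bounded C₀-groups: Let A be the generator of a bounded C₀-group T with ‖T(t)‖ ≤ M, with σ(A) = {iλ_k : k ∈ ℤ, k ≠ 0} as in the spectral assumption, and let P_k be the associated Riesz projections. If Σ_{k ∈ ℤ, k ≠ 0} 1/|λ_k| < ∞, then for every x ∈ D(A) the series Σ_{k ∈ ℤ, k ≠ 0} P_k x converges absolutely (Σ_k ‖P_k x‖ < ∞) and Σ_{k ∈ ℤ, k ≠ 0} P_k x = x. -/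
open MeasureTheory Complex Filter Topology Metric

namespace SpectralDecomp

variable {G : Type*} [NormedAddCommGroup G] [NormedSpace ℂ G]

/-- `R` is the bounded inverse of `z • I - A`. -/
structure ResolventAt (A : G →ₗ.[ℂ] G) (z : ℂ) (R : G →L[ℂ] G) : Prop where
  mem : ∀ y : G, R y ∈ A.domain
  solves : ∀ y : G, z • R y - A ⟨R y, mem y⟩ = y
  leftInv : ∀ x : A.domain, R (z • (x : G) - A x) = x

/-- The resolvent set of the (unbounded) operator `A`. -/
def resolventSet (A : G →ₗ.[ℂ] G) : Set ℂ :=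
  {z : ℂ | ∃ R : G →L[ℂ] G, ResolventAt A z R}

/-- The spectrum of the (unbounded) operator `A`. -/
def spectrumSet (A : G →ₗ.[ℂ] G) : Set ℂ := (resolventSet A)ᶜ

/-- Membership in the domain of `A ^ j`. -/
def InDomPow (A : G →ₗ.[ℂ] G) : ℕ → G → Prop
  | 0, _ => True
  | j + 1, x => ∃ h : x ∈ A.domain, InDomPow A j (A ⟨x, h⟩)

/-- The value `A ^ j x` for `x ∈ D(A ^ j)`. -/
noncomputable def powApply (A : G →ₗ.[ℂ] G) : (j : ℕ) → (x : G) → InDomPow A j x → G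
  | 0, x, _ => x
  | j + 1, x, h => powApply A j (A ⟨x, h.choose⟩) h.choose_spec

/-- `A` generates an `n`-times integrated group `(Sp, Sm)` bounded by `M * (1 + |t| ^ m)`. -/
def Generates (A : G →ₗ.[ℂ] G) (n m : ℕ) (M : ℝ) (Sp Sm : ℝ → G →L[ℂ] G) : Prop :=
  (∀ x : G, ContinuousOn (fun t : ℝ => Sp t x) (Set.Ici 0)) ∧
  (∀ x : G, ContinuousOn (fun t : ℝ => Sm t x) (Set.Ici 0)) ∧
  (∀ t : ℝ, 0 ≤ t → ‖Sp t‖ ≤ M * (1 + t ^ m)) ∧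
  (∀ t : ℝ, 0 ≤ t → ‖Sm t‖ ≤ M * (1 + t ^ m)) ∧
  (∀ z : ℂ, 0 < z.re →
    (∃ R : G →L[ℂ] G, ResolventAt A z R ∧
      ∀ x : G, R x = z ^ n • ∫ t in Set.Ioi (0 : ℝ), Complex.exp (-z * t) • Sp t x) ∧
    (∃ R : G →L[ℂ] G, ResolventAt A (-z) R ∧
      ∀ x : G, -(R x) = z ^ n • ∫ t in Set.Ioi (0 : ℝ), Complex.exp (-z * t) • Sm t x))

/-- The Riesz projection associated to the circle of centre `c` and radius `ρ`,
built from the resolvent function `Rres`. -/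
noncomputable def rieszProj (Rres : ℂ → G →L[ℂ] G) (c : ℂ) (ρ : ℝ) : G →L[ℂ] G :=
  (2 * Real.pi * Complex.I)⁻¹ • (∮ z in C(c, ρ), Rres z)

theorem map_circleIntegral {F H : Type*} [NormedAddCommGroup F] [NormedSpace ℂ F] [CompleteSpace F]
    [NormedAddCommGroup H] [NormedSpace ℂ H] [CompleteSpace H] (L : F →L[ℂ] H) {f : ℂ → F}
    {c : ℂ} {ρ : ℝ} (hf : CircleIntegrable f c ρ) :
    (∮ z in C(c, ρ), L (f z)) = L (∮ z in C(c, ρ), f z) := by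
  simp only [circleIntegral]
  rw [← L.intervalIntegral_comp_comm hf.out]
  simp

section Moments

variable {F : Type*} [NormedAddCommGroup F] [NormedSpace ℂ F]
  {f : ℂ → F} {c : ℂ} {ρ M : ℝ}

theorem norm_sq_add_sq_smul_le {w : ℂ} {s : ℝ} (hs : 0 ≤ s) (hw : ‖w‖ = s) {v : F}
    (hv : ‖v‖ * |w.re| ≤ M) : ‖(w ^ 2 + (s : ℂ) ^ 2) • v‖ ≤ 2 * s * M := by
  have h : w ^ 2 + (s : ℂ) ^ 2 = w * ((2 * w.re : ℝ) : ℂ) := by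
    have h1 : (s : ℂ) ^ 2 = w * (starRingEnd ℂ) w := by
      rw [Complex.mul_conj, Complex.normSq_eq_norm_sq, hw]; push_cast; ring
    rw [h1, ← Complex.add_conj]; ring
  rw [h, norm_smul, norm_mul, hw, Complex.norm_real, Real.norm_eq_abs, abs_mul, abs_two]
  nlinarith [mul_le_mul_of_nonneg_left hv hs]

theorem continuousOn_zpow_smul (hf : ∀ z ∈ closedBall c ρ, z ≠ c → DifferentiableAt ℂ f z) (n : ℤ) :
    ContinuousOn (fun z => (z - c) ^ n • f z) (closedBall c ρ \ {c}) := by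
  intro z hz
  have hzc : z ≠ c := hz.2
  refine ContinuousAt.continuousWithinAt (ContinuousAt.smul ?_ (hf z hz.1 hzc).continuousAt)
  exact ContinuousAt.zpow₀ (by fun_prop) n (Or.inl (sub_ne_zero.2 hzc))

theorem circleIntegral_zpow_smul_eq [CompleteSpace F]
    (hf : ∀ z ∈ closedBall c ρ, z ≠ c → DifferentiableAt ℂ f z)
    (n : ℤ) {s : ℝ} (hs : 0 < s) (hsρ : s ≤ ρ) :
    (∮ z in C(c, ρ), (z - c) ^ n • f z) = ∮ z in C(c, s), (z - c) ^ n • f z := by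
  refine Complex.circleIntegral_eq_of_differentiable_on_annulus_off_countable hs hsρ
    Set.countable_empty ((continuousOn_zpow_smul hf n).mono ?_) ?_
  · rintro z ⟨hz, hz'⟩
    refine ⟨hz, ?_⟩
    rintro rfl
    exact hz' (mem_ball_self hs)
  · rintro z ⟨⟨hz, hz'⟩, -⟩
    have hzc : z ≠ c := by
      rintro rfl
      exact hz' (mem_closedBall_self hs.le)
    refine DifferentiableAt.smul ?_ (hf z (ball_subset_closedBall hz) hzc)
    exact DifferentiableAt.zpow (by fun_prop) (Or.inl (sub_ne_zero.2 hzc))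

theorem norm_moment_add_le [CompleteSpace F]
    (hf : ∀ z ∈ closedBall c ρ, z ≠ c → DifferentiableAt ℂ f z)
    (hb : ∀ z ∈ closedBall c ρ, z ≠ c → ‖f z‖ * |(z - c).re| ≤ M)
    (n : ℤ) {s : ℝ} (hs : 0 < s) (hsρ : s ≤ ρ) :
    ‖(∮ z in C(c, ρ), (z - c) ^ (n + 2) • f z) + (s : ℂ) ^ 2 • ∮ z in C(c, ρ), (z - c) ^ n • f z‖
      ≤ 4 * Real.pi * M * s ^ (n + 2) := by
  have hsub : sphere c s ⊆ closedBall c ρ \ {c} := by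
    intro z hz
    refine ⟨sphere_subset_closedBall.trans (closedBall_subset_closedBall hsρ) hz, ?_⟩
    rintro rfl
    simp [hs.ne] at hz
  have hint (m : ℤ) : CircleIntegrable (fun z => (z - c) ^ m • f z) c s :=
    ((continuousOn_zpow_smul hf m).mono hsub).circleIntegrable hs.le
  rw [circleIntegral_zpow_smul_eq hf _ hs hsρ, circleIntegral_zpow_smul_eq hf _ hs hsρ,
    ← circleIntegral.integral_smul, ← circleIntegral.integral_add (hint _) ((hint n).fun_continuousOn_smul continuousOn_const)]
  have key : ∀ z ∈ sphere c s,
      ‖(z - c) ^ (n + 2) • f z + (s : ℂ) ^ 2 • (z - c) ^ n • f z‖ ≤ s ^ n * (2 * s * M) := by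
    intro z hz
    have hzc : z ≠ c := (hsub hz).2
    have hn : ‖z - c‖ = s := by simpa [dist_eq_norm] using hz
    have h1 : (z - c) ^ (n + 2) • f z + (s : ℂ) ^ 2 • (z - c) ^ n • f z =
        (z - c) ^ n • ((z - c) ^ 2 + (s : ℂ) ^ 2) • f z := by
      rw [zpow_add₀ (sub_ne_zero.2 hzc), smul_smul, smul_smul, ← add_smul]
      congr 1
      norm_cast
      ring
    rw [h1, norm_smul, norm_zpow, hn]
    gcongr
    exact norm_sq_add_sq_smul_le hs.le hn (hb z (hsub hz).1 hzc)
  refine (circleIntegral.norm_integral_le_of_norm_le_const hs.le key).trans_eq ?_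
  rw [zpow_add₀ hs.ne']
  norm_cast
  ring

theorem moment_eq_zero [CompleteSpace F] (hρ : 0 < ρ)
    (hf : ∀ z ∈ closedBall c ρ, z ≠ c → DifferentiableAt ℂ f z)
    (hb : ∀ z ∈ closedBall c ρ, z ≠ c → ‖f z‖ * |(z - c).re| ≤ M) {n : ℕ} (hn : n ≠ 0) :
    (∮ z in C(c, ρ), (z - c) ^ n • f z) = 0 := by
  have hmem : ∀ᶠ s : ℝ in 𝓝[>] 0, 0 < s ∧ s ≤ ρ :=
    Filter.mem_of_superset (Ioc_mem_nhdsGT hρ) fun s hs => hs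
  set a := ∮ z in C(c, ρ), (z - c) ^ n • f z with ha
  set b := ∮ z in C(c, ρ), (z - c) ^ ((n : ℤ) - 2) • f z with hb'
  have h1 : Tendsto (fun s : ℝ => ‖a + (s : ℂ) ^ 2 • b‖) (𝓝[>] 0) (𝓝 ‖a‖) := by
    have : ContinuousAt (fun s : ℝ => ‖a + (s : ℂ) ^ 2 • b‖) 0 := by fun_prop
    simpa using this.tendsto.mono_left nhdsWithin_le_nhds
  have h2 : Tendsto (fun s : ℝ => 4 * Real.pi * M * s ^ n) (𝓝[>] 0) (𝓝 0) := by
    have : ContinuousAt (fun s : ℝ => 4 * Real.pi * M * s ^ n) 0 := by fun_prop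
    simpa [hn] using this.tendsto.mono_left nhdsWithin_le_nhds
  have h3 : ‖a‖ ≤ 0 := by
    refine le_of_tendsto_of_tendsto h1 h2 (hmem.mono fun s hs => ?_)
    have := norm_moment_add_le hf hb ((n : ℤ) - 2) hs.1 hs.2
    simpa [a, b] using this
  exact norm_le_zero_iff.1 h3

theorem norm_circleIntegral_le [CompleteSpace F] (hρ : 0 < ρ)
    (hf : ∀ z ∈ closedBall c ρ, z ≠ c → DifferentiableAt ℂ f z)
    (hb : ∀ z ∈ closedBall c ρ, z ≠ c → ‖f z‖ * |(z - c).re| ≤ M) :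
    ‖∮ z in C(c, ρ), f z‖ ≤ 4 * Real.pi * M := by
  have h := norm_moment_add_le hf hb 0 hρ le_rfl
  have h2 := moment_eq_zero hρ hf hb two_ne_zero
  have h3 : (∮ z in C(c, ρ), (z - c) ^ ((0 : ℤ) + 2) • f z) = 0 := by
    rw [← h2]; norm_cast
  rw [h3, zero_add, norm_smul] at h
  simp only [zpow_zero, one_smul, norm_pow, Complex.norm_real, Real.norm_eq_abs, abs_of_pos hρ,
    zero_add] at h
  have hp : 0 < ρ ^ 2 := by positivity
  have h4 : ρ ^ (2 : ℤ) = ρ ^ 2 := by norm_cast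
  rw [h4, mul_comm] at h
  exact le_of_mul_le_mul_right h hp

end Moments

theorem eq_zero_of_norm_mul_abs_re_le {F : Type*} [NormedAddCommGroup F] [NormedSpace ℂ F]
    {f : ℂ → F} (hf : Differentiable ℂ f) {M : ℝ} (hb : ∀ z, ‖f z‖ * |z.re| ≤ M) (z : ℂ) :
    f z = 0 := by
  have key : ∀ᶠ R : ℝ in atTop, ‖f z‖ ≤ 2 * R * M / (R ^ 2 - ‖z‖ ^ 2) := by
    filter_upwards [eventually_gt_atTop ‖z‖] with R hR
    have hR0 : 0 < R := (norm_nonneg z).trans_lt hR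
    have hd : DiffContOnCl ℂ (fun w : ℂ => (w ^ 2 + (R : ℂ) ^ 2) • f w) (ball 0 R) :=
      Differentiable.diffContOnCl (by fun_prop)
    have h1 := Complex.norm_le_of_forall_mem_frontier_norm_le (C := 2 * R * M) isBounded_ball hd
      (fun w hw => norm_sq_add_sq_smul_le hR0.le
        (by simpa [frontier_ball _ hR0.ne'] using hw) (hb w))
      (subset_closure (by simpa using hR) : z ∈ closure (ball 0 R))
    have h2 : R ^ 2 - ‖z‖ ^ 2 ≤ ‖z ^ 2 + (R : ℂ) ^ 2‖ := by
      have := norm_sub_le_norm_add ((R : ℂ) ^ 2) (z ^ 2)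
      rw [add_comm]
      simpa [abs_of_pos hR0] using this
    have h3 : 0 < R ^ 2 - ‖z‖ ^ 2 := by nlinarith [norm_nonneg z]
    rw [le_div_iff₀ h3, mul_comm]
    rw [norm_smul] at h1
    exact (mul_le_mul_of_nonneg_right h2 (norm_nonneg _)).trans h1
  have hlim : Tendsto (fun R : ℝ => 2 * R * M / (R ^ 2 - ‖z‖ ^ 2)) atTop (𝓝 0) := by
    have h1 : Tendsto (fun R : ℝ => 2 * M * R⁻¹ / (1 - ‖z‖ ^ 2 * (R⁻¹) ^ 2)) atTop (𝓝 0) := by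
      have hc : ContinuousAt (fun y : ℝ => 2 * M * y / (1 - ‖z‖ ^ 2 * y ^ 2)) 0 := by
        refine ContinuousAt.div (by fun_prop) (by fun_prop) (by simp)
      simpa [Function.comp_def] using hc.tendsto.comp tendsto_inv_atTop_zero
    refine h1.congr' ?_
    filter_upwards [eventually_gt_atTop 0, eventually_gt_atTop ‖z‖] with R hR hRz
    have h3 : R ^ 2 - ‖z‖ ^ 2 ≠ 0 := by nlinarith [norm_nonneg z]
    have h4 : 1 - ‖z‖ ^ 2 * (R⁻¹) ^ 2 ≠ 0 := by
      have : 1 - ‖z‖ ^ 2 * (R⁻¹) ^ 2 = (R ^ 2 - ‖z‖ ^ 2) / R ^ 2 := by field_simp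
      rw [this]
      exact div_ne_zero h3 (by positivity)
    field_simp
  exact norm_le_zero_iff.1 (ge_of_tendsto hlim key)

section Resolvent

variable {A : G →ₗ.[ℂ] G}

theorem ResolventAt.sub_eq {z w : ℂ} {R S : G →L[ℂ] G} (hR : ResolventAt A z R)
    (hS : ResolventAt A w S) : R - S = (w - z) • R ∘L S := by
  ext y
  have h1 := hR.leftInv ⟨S y, hS.mem y⟩
  have h2 := hS.solves y
  have h3 : z • S y - A ⟨S y, hS.mem y⟩ = y - (w - z) • S y := by
    linear_combination (norm := module) h2
  simp only [h3, map_sub, map_smul] at h1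
  simp only [sub_apply, smul_apply, ContinuousLinearMap.comp_apply]
  rw [sub_eq_iff_eq_add] at h1
  rw [sub_eq_iff_eq_add', h1]

theorem ResolventAt.unique {z : ℂ} {R S : G →L[ℂ] G} (hR : ResolventAt A z R)
    (hS : ResolventAt A z S) : R = S := by
  simpa [sub_eq_zero] using hR.sub_eq hS

theorem ResolventAt.commute {z w : ℂ} {R S : G →L[ℂ] G} (hR : ResolventAt A z R)
    (hS : ResolventAt A w S) : R ∘L S = S ∘L R := by
  rcases eq_or_ne z w with rfl | hzw
  · rw [hR.unique hS]
  · have h : (w - z) • (R ∘L S) = (w - z) • (S ∘L R) := by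
      rw [← hR.sub_eq hS, ← neg_sub S R, hS.sub_eq hR, ← neg_smul, neg_sub]
    exact smul_right_injective _ (sub_ne_zero.2 hzw.symm) h

theorem ResolventAt.of_isUnit {z w : ℂ} {R : G →L[ℂ] G} (hR : ResolventAt A z R)
    (hu : IsUnit (1 + (w - z) • R)) :
    ResolventAt A w (R ∘L Ring.inverse (1 + (w - z) • R)) := by
  set V := Ring.inverse (1 + (w - z) • R)
  have hV1 : ∀ y, V y + (w - z) • R (V y) = y := fun y => by
    simpa using DFunLike.congr_fun (Ring.mul_inverse_cancel _ hu) y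
  have hV2 : ∀ y, V (y + (w - z) • R y) = y := fun y => by
    simpa using DFunLike.congr_fun (Ring.inverse_mul_cancel _ hu) y
  refine ⟨fun y => hR.mem _, fun y => ?_, fun x => ?_⟩
  · have h := hR.solves (V y)
    calc w • R (V y) - A ⟨R (V y), hR.mem _⟩
        = (z • R (V y) - A ⟨R (V y), hR.mem _⟩) + (w - z) • R (V y) := by module
      _ = y := by rw [h, hV1]
  · have h := hR.leftInv x
    have h1 : w • (x : G) - A x =
        (z • (x : G) - A x) + (w - z) • R (z • (x : G) - A x) := by
      rw [h]; module
    rw [ContinuousLinearMap.comp_apply, h1, hV2, h]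

variable [CompleteSpace G] {Rres : ℂ → G →L[ℂ] G}

theorem eventually_isUnit_one_add_smul (R : G →L[ℂ] G) (z : ℂ) :
    ∀ᶠ w in 𝓝 z, IsUnit (1 + (w - z) • R) := by
  have hc : ContinuousAt (fun w : ℂ => 1 + (w - z) • R) z := by fun_prop
  refine hc.eventually_mem (Units.isOpen.mem_nhds ?_)
  simp

theorem isOpen_resolventSet : IsOpen (resolventSet A) := by
  rw [isOpen_iff_mem_nhds]
  rintro z ⟨R, hR⟩
  filter_upwards [eventually_isUnit_one_add_smul R z] with w hw
  exact ⟨_, hR.of_isUnit hw⟩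

theorem differentiableAt_resolvent (hres : ∀ z ∈ resolventSet A, ResolventAt A z (Rres z))
    {z : ℂ} (hz : z ∈ resolventSet A) : DifferentiableAt ℂ Rres z := by
  have h : Rres =ᶠ[𝓝 z] fun w => Rres z ∘L Ring.inverse (1 + (w - z) • Rres z) := by
    filter_upwards [eventually_isUnit_one_add_smul (Rres z) z, isOpen_resolventSet.mem_nhds hz]
      with w hw hw'
    exact (hres w hw').unique ((hres z hz).of_isUnit hw)
  refine DifferentiableAt.congr_of_eventuallyEq ?_ h
  refine (differentiableAt_const _).clm_comp ?_
  refine DifferentiableAt.comp z (g := Ring.inverse) ?_ (by fun_prop)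
  exact differentiableAt_inverse (by simp)

end Resolvent

theorem norm_resolvent_mul_abs_re_le {T : ℝ → G →L[ℂ] G} {M : ℝ}
    (hT0 : T 0 = 1) (hTmul : ∀ s t : ℝ, T (s + t) = T s ∘L T t) (hTbd : ∀ t : ℝ, ‖T t‖ ≤ M)
    {A : G →ₗ.[ℂ] G}
    (hgen : ∀ x : A.domain, Tendsto (fun t : ℝ => ((t : ℂ))⁻¹ • (T t x - x)) (𝓝[≠] 0) (𝓝 (A x)))
    {z : ℂ} {R : G →L[ℂ] G} (hR : ResolventAt A z R) : ‖R‖ * |z.re| ≤ M := by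
  have hM : 0 ≤ M := (norm_nonneg _).trans (hTbd 0)
  set N : G → ℝ := fun x => ⨆ t, ‖T t x‖ with hN
  have hTle (t : ℝ) (x : G) : ‖T t x‖ ≤ M * ‖x‖ := (T t).le_of_opNorm_le (hTbd t) x
  have hbdd (x : G) : BddAbove (Set.range fun t => ‖T t x‖) :=
    ⟨M * ‖x‖, by rintro _ ⟨t, rfl⟩; exact hTle t x⟩
  have hleN (t : ℝ) (x : G) : ‖T t x‖ ≤ N x := le_ciSup (hbdd x) t
  have hNle (x : G) : N x ≤ M * ‖x‖ := ciSup_le fun t => hTle t x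
  have hnorm (x : G) : ‖x‖ ≤ N x := by simpa [hT0] using hleN 0 x
  have hNT (h : ℝ) (x : G) : N (T h x) ≤ N x := ciSup_le fun t => by
    simpa [hTmul] using hleN (t + h) x
  have hNadd (x y : G) : N (x + y) ≤ N x + N y := ciSup_le fun t => by
    rw [map_add]
    exact (norm_add_le _ _).trans (add_le_add (hleN t x) (hleN t y))
  have hNsmul (a : ℂ) (x : G) : N (a • x) = ‖a‖ * N x := by
    simp only [hN, map_smul, norm_smul]
    rw [Real.mul_iSup_of_nonneg (norm_nonneg a)]
  have key (x : A.domain) : |z.re| * N x ≤ N (z • (x : G) - A x) := by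
    have hlow (h : ℝ) (hh : h ≠ 0) (hs : 0 ≤ h * z.re) :
        |z.re| * N x ≤ N (z • (x : G) - A x) + M * ‖((h : ℂ))⁻¹ • (T h x - x) - A x‖ := by
      set e := ((h : ℂ))⁻¹ • (T h x - x) - A x with he
      have hhc : (h : ℂ) ≠ 0 := by exact_mod_cast hh
      have hx : (1 + h * z) • (x : G) = T h x + (h : ℂ) • ((z • (x : G) - A x) + (-1 : ℂ) • e) := by
        have : (h : ℂ) • e = T h x - x - (h : ℂ) • A x := by
          rw [he, smul_sub, smul_inv_smul₀ hhc]
        have h2 : (h : ℂ) • ((z • (x : G) - A x) + (-1 : ℂ) • e)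
          = (h : ℂ) • (z • (x : G) - A x) - (h : ℂ) • e := by module
        rw [h2, this]
        module
      have h1 : ‖(1 + h * z : ℂ)‖ * N x ≤
          N x + |h| * (N (z • (x : G) - A x) + M * ‖e‖) := by
        rw [← hNsmul, hx]
        refine (hNadd _ _).trans (add_le_add (hNT h x) ?_)
        rw [hNsmul, Complex.norm_real, Real.norm_eq_abs]
        refine mul_le_mul_of_nonneg_left ((hNadd _ _).trans ?_) (abs_nonneg _)
        rw [hNsmul]
        simpa using hNle e
      have h2 : 1 + |h| * |z.re| ≤ ‖(1 + h * z : ℂ)‖ := by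
        have := Complex.re_le_norm (1 + h * z)
        rw [← abs_mul, abs_of_nonneg hs]
        simpa using this
      have h3 := mul_le_mul_of_nonneg_right h2 ((norm_nonneg _).trans (hnorm x))
      have h4 : |h| * (|z.re| * N x) ≤ |h| * (N (z • (x : G) - A x) + M * ‖e‖) := by linarith
      exact le_of_mul_le_mul_left h4 (abs_pos.2 hh)
    have hlim : Tendsto (fun h : ℝ => N (z • (x : G) - A x) +
        M * ‖((h : ℂ))⁻¹ • (T h x - x) - A x‖) (𝓝[≠] 0) (𝓝 (N (z • (x : G) - A x))) := by
      have := (((hgen x).sub_const (A x)).norm.const_mul M).const_add (N (z • (x : G) - A x))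
      simpa using this
    rcases le_total 0 z.re with hz | hz
    · refine ge_of_tendsto (hlim.mono_left (nhdsGT_le_nhdsNE 0)) ?_
      filter_upwards [self_mem_nhdsWithin] with h (hh : 0 < h)
      exact hlow h hh.ne' (mul_nonneg hh.le hz)
    · refine ge_of_tendsto (hlim.mono_left (nhdsLT_le_nhdsNE 0)) ?_
      filter_upwards [self_mem_nhdsWithin] with h (hh : h < 0)
      exact hlow h hh.ne (mul_nonneg_of_nonpos_of_nonpos hh.le hz)
  rcases (abs_nonneg z.re).eq_or_lt with h0 | h0
  · rw [← h0, mul_zero]; exact hM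
  rw [← le_div_iff₀ h0]
  refine R.opNorm_le_bound (by positivity) fun y => ?_
  have h := key ⟨R y, hR.mem y⟩
  rw [hR.solves] at h
  have h' := (mul_le_mul_of_nonneg_left (hnorm (R y)) h0.le).trans (h.trans (hNle y))
  rw [div_mul_eq_mul_div, le_div_iff₀ h0]
  linarith

section Riesz

variable [CompleteSpace G] {A : G →ₗ.[ℂ] G} {Rres : ℂ → G →L[ℂ] G} {c : ℂ} {ρ M : ℝ}

theorem continuousOn_resolvent_sphere (hres : ∀ z ∈ resolventSet A, ResolventAt A z (Rres z))
    (hρ : 0 < ρ) (hball : ∀ z ∈ closedBall c ρ, z ≠ c → z ∈ resolventSet A) :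
    ContinuousOn Rres (sphere c ρ) := fun z hz =>
  (differentiableAt_resolvent hres
    (hball z (sphere_subset_closedBall hz) (ne_of_mem_sphere hz hρ.ne'))).continuousAt
    |>.continuousWithinAt

theorem map_rieszProj {H : Type*} [NormedAddCommGroup H] [NormedSpace ℂ H] [CompleteSpace H]
    (hres : ∀ z ∈ resolventSet A, ResolventAt A z (Rres z))
    (hρ : 0 < ρ) (hball : ∀ z ∈ closedBall c ρ, z ≠ c → z ∈ resolventSet A)
    (L : (G →L[ℂ] G) →L[ℂ] H) :
    L (rieszProj Rres c ρ) = (2 * Real.pi * Complex.I : ℂ)⁻¹ • ∮ z in C(c, ρ), L (Rres z) := by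
  rw [map_circleIntegral L
    ((continuousOn_resolvent_sphere hres hρ hball).circleIntegrable hρ.le), rieszProj, map_smul]

theorem rieszProj_apply (hres : ∀ z ∈ resolventSet A, ResolventAt A z (Rres z))
    (hρ : 0 < ρ) (hball : ∀ z ∈ closedBall c ρ, z ≠ c → z ∈ resolventSet A) (v : G) :
    rieszProj Rres c ρ v = (2 * Real.pi * Complex.I : ℂ)⁻¹ • ∮ z in C(c, ρ), Rres z v :=
  map_rieszProj hres hρ hball (ContinuousLinearMap.apply ℂ G v)

theorem norm_rieszProj_le (hres : ∀ z ∈ resolventSet A, ResolventAt A z (Rres z))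
    (hρ : 0 < ρ) (hball : ∀ z ∈ closedBall c ρ, z ≠ c → z ∈ resolventSet A)
    (hc : c.re = 0) (hb : ∀ z ∈ resolventSet A, ‖Rres z‖ * |z.re| ≤ M) :
    ‖rieszProj Rres c ρ‖ ≤ 2 * M := by
  have h := norm_circleIntegral_le hρ (f := Rres) (M := M)
    (fun z hz hzc => differentiableAt_resolvent hres (hball z hz hzc))
    (fun z hz hzc => by simpa [hc] using hb z (hball z hz hzc))
  have hpi := Real.pi_pos
  rw [rieszProj, norm_smul]
  have h2 : ‖(2 * Real.pi * Complex.I : ℂ)⁻¹‖ = (2 * Real.pi)⁻¹ := by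
    simp [abs_of_pos hpi]
  rw [h2, inv_mul_le_iff₀ (by positivity)]
  linarith

theorem rieszProj_generator (hres : ∀ z ∈ resolventSet A, ResolventAt A z (Rres z))
    (hρ : 0 < ρ) (hball : ∀ z ∈ closedBall c ρ, z ≠ c → z ∈ resolventSet A)
    (hc : c.re = 0) (hb : ∀ z ∈ resolventSet A, ‖Rres z‖ * |z.re| ≤ M) (x : A.domain) :
    rieszProj Rres c ρ (A x) = c • rieszProj Rres c ρ x := by
  have hcont : ContinuousOn (fun z => Rres z (x : G)) (sphere c ρ) :=
    (continuousOn_resolvent_sphere hres hρ hball).clm_apply continuousOn_const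
  have hmom : (∮ z in C(c, ρ), (z - c) ^ 1 • Rres z (x : G)) = 0 := by
    refine moment_eq_zero hρ (M := M * ‖(x : G)‖) (fun z hz hzc => ?_) (fun z hz hzc => ?_)
      one_ne_zero
    · exact (differentiableAt_resolvent hres (hball z hz hzc)).clm_apply (differentiableAt_const _)
    · have h1 := hb z (hball z hz hzc)
      have h2 := (Rres z).le_opNorm (x : G)
      calc ‖Rres z (x : G)‖ * |(z - c).re| ≤ ‖Rres z‖ * ‖(x : G)‖ * |z.re| := by
            simp only [Complex.sub_re, hc, sub_zero]; gcongr
        _ = ‖Rres z‖ * |z.re| * ‖(x : G)‖ := by ring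
        _ ≤ M * ‖(x : G)‖ := by gcongr
  have hconst : (∮ _z in C(c, ρ), (x : G)) = 0 :=
    diffContOnCl_const.circleIntegral_eq_zero hρ.le
  have hpt : Set.EqOn (fun z => Rres z (A x))
      (fun z => (z - c) ^ 1 • Rres z (x : G) + (c • Rres z (x : G) - (x : G))) (sphere c ρ) := by
    intro z hz
    have h := (hres z (hball z (sphere_subset_closedBall hz)
      (ne_of_mem_sphere hz hρ.ne'))).leftInv x
    rw [map_sub, map_smul] at h
    linear_combination (norm := module) -h
  have i1 : CircleIntegrable (fun z => (z - c) ^ 1 • Rres z (x : G)) c ρ :=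
    ContinuousOn.circleIntegrable hρ.le (ContinuousOn.smul (by fun_prop) hcont)
  have i2 : CircleIntegrable (fun z => c • Rres z (x : G)) c ρ :=
    ContinuousOn.circleIntegrable hρ.le (hcont.const_smul c)
  have i3 : CircleIntegrable (fun _ => (x : G)) c ρ := circleIntegrable_const _ _ _
  rw [rieszProj_apply hres hρ hball, rieszProj_apply hres hρ hball,
    circleIntegral.integral_congr hρ.le hpt,
    circleIntegral.integral_add i1 (CircleIntegrable.fun_sub i2 i3),
    circleIntegral.integral_sub i2 i3, circleIntegral.integral_smul, hmom, hconst, smul_comm c]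
  simp

theorem resolvent_rieszProj_comm (hres : ∀ z ∈ resolventSet A, ResolventAt A z (Rres z))
    (hρ : 0 < ρ) (hball : ∀ z ∈ closedBall c ρ, z ≠ c → z ∈ resolventSet A)
    {w : ℂ} (hw : w ∈ resolventSet A) (v : G) :
    Rres w (rieszProj Rres c ρ v) = rieszProj Rres c ρ (Rres w v) := by
  have h := map_rieszProj hres hρ hball (Rres w ∘L ContinuousLinearMap.apply ℂ G v)
  rw [rieszProj_apply hres hρ hball (Rres w v)]
  refine h.trans (congrArg _ (circleIntegral.integral_congr hρ.le fun z hz => ?_))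
  exact DFunLike.congr_fun ((hres w hw).commute (hres z (hball z (sphere_subset_closedBall hz)
    (ne_of_mem_sphere hz hρ.ne')))) v

theorem resolvent_rieszProj (hres : ∀ z ∈ resolventSet A, ResolventAt A z (Rres z))
    (hρ : 0 < ρ) (hball : ∀ z ∈ closedBall c ρ, z ≠ c → z ∈ resolventSet A)
    (hc : c.re = 0) (hb : ∀ z ∈ resolventSet A, ‖Rres z‖ * |z.re| ≤ M)
    {w : ℂ} (hw : w ∈ resolventSet A) (hwc : w ≠ c) (v : G) :
    Rres w (rieszProj Rres c ρ v) = (w - c)⁻¹ • rieszProj Rres c ρ v := by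
  have h1 := rieszProj_generator hres hρ hball hc hb ⟨Rres w v, (hres w hw).mem v⟩
  have h2 : A ⟨Rres w v, (hres w hw).mem v⟩ = w • Rres w v - v := by
    linear_combination (norm := module) -(hres w hw).solves v
  rw [h2, map_sub, map_smul] at h1
  rw [resolvent_rieszProj_comm hres hρ hball hw, eq_inv_smul_iff₀ (sub_ne_zero.2 hwc)]
  linear_combination (norm := module) h1

theorem rieszProj_rieszProj_self (hres : ∀ z ∈ resolventSet A, ResolventAt A z (Rres z))
    (hρ : 0 < ρ) (hball : ∀ z ∈ closedBall c ρ, z ≠ c → z ∈ resolventSet A)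
    (hc : c.re = 0) (hb : ∀ z ∈ resolventSet A, ‖Rres z‖ * |z.re| ≤ M) (v : G) :
    rieszProj Rres c ρ (rieszProj Rres c ρ v) = rieszProj Rres c ρ v := by
  have h : Set.EqOn (fun z => Rres z (rieszProj Rres c ρ v))
      (fun z => (z - c)⁻¹ • rieszProj Rres c ρ v) (sphere c ρ) := fun z hz =>
    have hzc := ne_of_mem_sphere hz hρ.ne'
    resolvent_rieszProj hres hρ hball hc hb (hball z (sphere_subset_closedBall hz) hzc) hzc v
  rw [rieszProj_apply hres hρ hball (rieszProj Rres c ρ v), circleIntegral.integral_congr hρ.le h,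
    circleIntegral.integral_smul_const, circleIntegral.integral_sub_center_inv c hρ.ne',
    inv_smul_smul₀ Complex.two_pi_I_ne_zero]

theorem rieszProj_rieszProj_of_notMem (hres : ∀ z ∈ resolventSet A, ResolventAt A z (Rres z))
    (hρ : 0 < ρ) (hball : ∀ z ∈ closedBall c ρ, z ≠ c → z ∈ resolventSet A)
    (hc : c.re = 0) (hb : ∀ z ∈ resolventSet A, ‖Rres z‖ * |z.re| ≤ M)
    {c' : ℂ} {ρ' : ℝ} (hρ' : 0 < ρ')
    (hball' : ∀ z ∈ closedBall c' ρ', z ≠ c' → z ∈ resolventSet A)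
    (hcc' : c ∉ closedBall c' ρ') (v : G) :
    rieszProj Rres c' ρ' (rieszProj Rres c ρ v) = 0 := by
  have hne : ∀ z ∈ closedBall c' ρ', z ≠ c := fun z hz h => hcc' (h ▸ hz)
  have h : Set.EqOn (fun z => Rres z (rieszProj Rres c ρ v))
      (fun z => (z - c)⁻¹ • rieszProj Rres c ρ v) (sphere c' ρ') := fun z hz =>
    resolvent_rieszProj hres hρ hball hc hb (hball' z (sphere_subset_closedBall hz)
      (ne_of_mem_sphere hz hρ'.ne')) (hne z (sphere_subset_closedBall hz)) v
  have hd : DiffContOnCl ℂ (fun z : ℂ => (z - c)⁻¹) (ball c' ρ') := by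
    refine DifferentiableOn.diffContOnCl fun z hz => ?_
    have hzc : z - c ≠ 0 := sub_ne_zero.2 (hne z (closure_ball_subset_closedBall hz))
    exact DifferentiableAt.differentiableWithinAt (by fun_prop (disch := exact hzc))
  rw [rieszProj_apply hres hρ' hball' (rieszProj Rres c ρ v),
    circleIntegral.integral_congr hρ'.le h, circleIntegral.integral_smul_const,
    hd.circleIntegral_eq_zero hρ'.le]
  simp

theorem exists_extension_resolvent (hres : ∀ z ∈ resolventSet A, ResolventAt A z (Rres z))
    (hρ : 0 < ρ) (hball : ∀ z ∈ closedBall c ρ, z ≠ c → z ∈ resolventSet A)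
    {u : G} (hu : rieszProj Rres c ρ u = 0) :
    ∃ g : ℂ → G, DifferentiableOn ℂ g (ball c ρ) ∧ ∀ z ∈ ball c ρ, z ≠ c → g z = Rres z u := by
  have hcont : ∀ v, ContinuousOn (fun z => Rres z v) (sphere c ρ) := fun v =>
    (continuousOn_resolvent_sphere hres hρ hball).clm_apply continuousOn_const
  refine ⟨fun w => (2 * Real.pi * Complex.I : ℂ)⁻¹ • ∮ z in C(c, ρ), (z - w)⁻¹ • Rres z u,
    ?_, fun w hw hwc => ?_⟩
  · lift ρ to NNReal using hρ.le
    rw [← Metric.eball_coe]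
    exact (hasFPowerSeriesOn_cauchy_integral ((hcont u).circleIntegrable hρ.le)
      hρ).differentiableOn
  · have hwρ := hball w (ball_subset_closedBall hw) hwc
    have hne : ∀ z ∈ sphere c ρ, z - w ≠ 0 := fun z hz => sub_ne_zero.2 fun h => by
      rw [h, mem_sphere] at hz
      exact (mem_ball.1 hw).ne hz
    have hpt : Set.EqOn (fun z => (z - w)⁻¹ • Rres z u)
        (fun z => (z - w)⁻¹ • Rres w u - Rres z (Rres w u)) (sphere c ρ) := by
      intro z hz
      have h := DFunLike.congr_fun ((hres z (hball z (sphere_subset_closedBall hz)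
        (ne_of_mem_sphere hz hρ.ne'))).sub_eq (hres w hwρ)) u
      simp only [sub_apply, smul_apply, ContinuousLinearMap.comp_apply] at h
      have h' : Rres z u = Rres w u - (z - w) • Rres z (Rres w u) := by
        linear_combination (norm := module) h
      change (z - w)⁻¹ • Rres z u = _
      rw [h', smul_sub, inv_smul_smul₀ (hne z hz)]
    have i1 : CircleIntegrable (fun z => (z - w)⁻¹ • Rres w u) c ρ :=
      ContinuousOn.circleIntegrable hρ.le
        (ContinuousOn.smul (ContinuousOn.inv₀ (by fun_prop) hne) continuousOn_const)
    have hP := rieszProj_apply hres hρ hball (Rres w u)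
    rw [← resolvent_rieszProj_comm hres hρ hball hwρ, hu, map_zero] at hP
    change (2 * Real.pi * Complex.I : ℂ)⁻¹ • (∮ z in C(c, ρ), (z - w)⁻¹ • Rres z u) = _
    rw [circleIntegral.integral_congr hρ.le hpt,
      circleIntegral.integral_sub i1 ((hcont _).circleIntegrable hρ.le), smul_sub, ← hP, sub_zero,
      circleIntegral.integral_smul_const, circleIntegral.integral_sub_inv_of_mem_ball hw,
      inv_smul_smul₀ Complex.two_pi_I_ne_zero]

theorem eq_zero_of_forall_rieszProj_eq_zero
    (hres : ∀ z ∈ resolventSet A, ResolventAt A z (Rres z))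
    (hM : 0 ≤ M) (hb : ∀ z ∈ resolventSet A, ‖Rres z‖ * |z.re| ≤ M)
    (hre : ∀ z ∈ spectrumSet A, z.re = 0) {u : G}
    (hu : ∀ c ∈ spectrumSet A, ∃ ρ > 0, (∀ z ∈ closedBall c ρ, z ≠ c → z ∈ resolventSet A) ∧
      rieszProj Rres c ρ u = 0) : u = 0 := by
  classical
  have hext : ∀ c, ∃ g : ℂ → G, c ∈ spectrumSet A → ∃ ρ > 0, DifferentiableOn ℂ g (ball c ρ) ∧
      ∀ z ∈ ball c ρ, z ≠ c → z ∈ resolventSet A ∧ g z = Rres z u := by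
    intro c
    by_cases hc : c ∈ spectrumSet A
    · obtain ⟨ρ, hρ, hball, h0⟩ := hu c hc
      obtain ⟨g, hg, hg'⟩ := exists_extension_resolvent hres hρ hball h0
      exact ⟨g, fun _ => ⟨ρ, hρ, hg, fun z hz hzc =>
        ⟨hball z (ball_subset_closedBall hz) hzc, hg' z hz hzc⟩⟩⟩
    · exact ⟨0, fun h => absurd h hc⟩
  choose g hg using hext
  set F : ℂ → G := fun z => if z ∈ resolventSet A then Rres z u else g z z with hF
  have hFd : Differentiable ℂ F := by
    intro z
    by_cases hz : z ∈ resolventSet A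
    · have h : F =ᶠ[𝓝 z] fun w => Rres w u := by
        filter_upwards [isOpen_resolventSet.mem_nhds hz] with w hw
        simp [hF, hw]
      exact ((differentiableAt_resolvent hres hz).clm_apply
        (differentiableAt_const u)).congr_of_eventuallyEq h
    · obtain ⟨ρ, hρ, hd, hgR⟩ := hg z hz
      have h : F =ᶠ[𝓝 z] g z := by
        filter_upwards [ball_mem_nhds z hρ] with w hw
        rcases eq_or_ne w z with rfl | hwz
        · simp [hF, hz]
        · simp [hF, (hgR w hw hwz).1, (hgR w hw hwz).2]
      exact (hd.differentiableAt (ball_mem_nhds z hρ)).congr_of_eventuallyEq h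
  have hFb : ∀ z, ‖F z‖ * |z.re| ≤ M * ‖u‖ := by
    intro z
    by_cases hz : z ∈ resolventSet A
    · simp only [hF, hz, if_true]
      calc ‖Rres z u‖ * |z.re| ≤ ‖Rres z‖ * ‖u‖ * |z.re| := by
            gcongr; exact (Rres z).le_opNorm u
        _ = ‖Rres z‖ * |z.re| * ‖u‖ := by ring
        _ ≤ M * ‖u‖ := by gcongr; exact hb z hz
    · simp only [hre z hz, abs_zero, mul_zero]
      positivity
  have h1 : (1 : ℂ) ∈ resolventSet A := by
    by_contra h
    simpa using hre 1 h
  have hR : Rres 1 u = 0 := by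
    simpa [hF, h1] using eq_zero_of_norm_mul_abs_re_le hFd hFb 1
  have hs := (hres 1 h1).solves u
  have hA : A ⟨Rres 1 u, (hres 1 h1).mem u⟩ = 0 := by
    rw [show (⟨Rres 1 u, (hres 1 h1).mem u⟩ : A.domain) = 0 from Subtype.ext hR, A.map_zero]
  rw [hA, hR] at hs
  simpa using hs.symm

end Riesz

/-- Spectral decomposition for bounded `C₀`-groups: if `A` generates the
bounded `C₀`-group `T` with `‖T t‖ ≤ M`, with discrete spectrum
`σ(A) = {iλ_k : k ∈ ℤ, k ≠ 0}` as in the spectral assumption, and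
`Σ_{k ≠ 0} 1 / |λ_k| < ∞`, then for every `x ∈ D(A)` the series `Σ_k P_k x`
converges absolutely and sums to `x`. -/
theorem spectral_decomposition_bounded_group
    {E : Type*} [NormedAddCommGroup E] [NormedSpace ℂ E] [CompleteSpace E]
    (T : ℝ → E →L[ℂ] E) (M : ℝ)
    (hT0 : T 0 = 1) (hTmul : ∀ s t : ℝ, T (s + t) = T s ∘L T t)
    (hTcont : ∀ x : E, Continuous fun t : ℝ => T t x)
    (hTbd : ∀ t : ℝ, ‖T t‖ ≤ M)
    (A : E →ₗ.[ℂ] E)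
    (hgen : ∀ x y : E, (∃ hx : x ∈ A.domain, A ⟨x, hx⟩ = y) ↔
      Filter.Tendsto (fun t : ℝ => ((t : ℂ))⁻¹ • (T t x - x))
        (nhdsWithin 0 {(0 : ℝ)}ᶜ) (nhds y))
    (Rres : ℂ → E →L[ℂ] E)
    (hres : ∀ z ∈ resolventSet A, ResolventAt A z (Rres z))
    (lam : ℤ → ℝ)
    (hmono : ∀ j k : ℤ, j ≠ 0 → k ≠ 0 → j < k → lam j < lam k)
    (hpos : ∀ k : ℤ, 0 < k → 0 < lam k)
    (hneg : ∀ k : ℤ, k < 0 → lam k < 0)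
    (hspec : spectrumSet A = {z : ℂ | ∃ k : ℤ, k ≠ 0 ∧ z = Complex.I * (lam k : ℂ)})
    (r : ℤ → ℝ) (hrpos : ∀ k : ℤ, k ≠ 0 → 0 < r k)
    (hrsep : ∀ k : ℤ, k ≠ 0 → ∀ z ∈ spectrumSet A,
      z ∈ Metric.closedBall (Complex.I * (lam k : ℂ)) (r k) → z = Complex.I * (lam k : ℂ))
    (hsum : Summable (fun k : {k : ℤ // k ≠ 0} => 1 / |lam k.1|))
    (x : E) (hx : x ∈ A.domain) :
    Summable (fun k : {k : ℤ // k ≠ 0} =>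
      ‖rieszProj Rres (Complex.I * (lam k.1 : ℂ)) (r k.1) x‖) ∧
    HasSum (fun k : {k : ℤ // k ≠ 0} =>
      rieszProj Rres (Complex.I * (lam k.1 : ℂ)) (r k.1) x) x := by
  have hb : ∀ z ∈ resolventSet A, ‖Rres z‖ * |z.re| ≤ M := fun z hz =>
    norm_resolvent_mul_abs_re_le hT0 hTmul hTbd
      (fun x => (hgen x (A x)).1 ⟨x.2, rfl⟩) (hres z hz)
  have hM : 0 ≤ M := (norm_nonneg _).trans (hTbd 0)
  have hinj : ∀ j k : ℤ, j ≠ 0 → k ≠ 0 → lam j = lam k → j = k := by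
    intro j k hj hk h
    rcases lt_trichotomy j k with hlt | heq | hlt
    · exact absurd h (hmono j k hj hk hlt).ne
    · exact heq
    · exact absurd h (hmono k j hk hj hlt).ne'
  have hlam : ∀ k : ℤ, k ≠ 0 → lam k ≠ 0 := fun k hk => by
    rcases hk.lt_or_gt with h | h
    · exact (hneg k h).ne
    · exact (hpos k h).ne'
  have hcre (k : ℤ) : (Complex.I * (lam k : ℂ)).re = 0 := by simp
  have hspecmem : ∀ k : ℤ, k ≠ 0 → Complex.I * (lam k : ℂ) ∈ spectrumSet A := fun k hk => by
    rw [hspec]; exact ⟨k, hk, rfl⟩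
  have hball : ∀ k : ℤ, k ≠ 0 → ∀ z ∈ closedBall (Complex.I * (lam k : ℂ)) (r k),
      z ≠ Complex.I * (lam k : ℂ) → z ∈ resolventSet A := fun k hk z hz hzc => by
    by_contra h
    exact hzc (hrsep k hk z h hz)
  set P : ℤ → E →L[ℂ] E := fun k => rieszProj Rres (Complex.I * (lam k : ℂ)) (r k) with hP
  have hsummable : Summable (fun k : {k : ℤ // k ≠ 0} => ‖P k.1 x‖) := by
    refine Summable.of_nonneg_of_le (fun _ => norm_nonneg _) (fun k => ?_)
      (hsum.mul_left (2 * M * ‖A ⟨x, hx⟩‖))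
    have h1 := rieszProj_generator hres (hrpos _ k.2) (hball _ k.2) (hcre _) hb ⟨x, hx⟩
    have h2 := (P k.1).le_of_opNorm_le
      (norm_rieszProj_le hres (hrpos _ k.2) (hball _ k.2) (hcre _) hb) (A ⟨x, hx⟩)
    have h3 : ‖P k.1 (A ⟨x, hx⟩)‖ = |lam k.1| * ‖P k.1 x‖ := by
      simp only [hP, h1, norm_smul]
      simp
    rw [mul_one_div, le_div_iff₀ (abs_pos.2 (hlam _ k.2)), mul_comm, ← h3]
    exact h2
  refine ⟨hsummable, ?_⟩
  obtain ⟨y, hy⟩ := hsummable.of_norm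
  suffices h : x - y = 0 by
    rwa [sub_eq_zero.1 h] at hy ⊢
  refine eq_zero_of_forall_rieszProj_eq_zero hres hM hb (fun z hz => ?_) (fun c hc => ?_)
  · rw [hspec] at hz
    obtain ⟨k, -, rfl⟩ := hz
    exact hcre k
  · rw [hspec] at hc
    obtain ⟨j, hj, rfl⟩ := hc
    refine ⟨r j, hrpos j hj, hball j hj, ?_⟩
    have h1 : HasSum (fun k : {k : ℤ // k ≠ 0} => P j (P k.1 x)) (P j y) := hy.mapL (P j)
    have h2 : HasSum (fun k : {k : ℤ // k ≠ 0} => P j (P k.1 x)) (P j (P j x)) := by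
      refine hasSum_single (⟨j, hj⟩ : {k : ℤ // k ≠ 0}) fun k hk => ?_
      refine rieszProj_rieszProj_of_notMem hres (hrpos _ k.2) (hball _ k.2) (hcre _) hb
        (hrpos j hj) (hball j hj) (fun hmem => hk (Subtype.ext ?_)) x
      have := hrsep j hj _ (hspecmem _ k.2) hmem
      exact hinj _ _ k.2 hj (by simpa using this)
    have h3 : P j (P j x) = P j x :=
      rieszProj_rieszProj_self hres (hrpos j hj) (hball j hj) (hcre j) hb x
    rw [map_sub, sub_eq_zero]
    exact ((h1.unique h2).trans h3).symm

end SpectralDecomp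
end

section
/- Nilpotency on spectral subspaces in the integrated group case: Let n ≥ 0 be an integer and suppose A generates an n-times integrated group bounded by M(1+|t|^n), with σ(A) = {iλ_k : k ∈ ℤ, k ≠ 0} as in the spectral assumption, and let P_k be the associated Riesz projections. Then for every k, P_k(E) ⊆ D(A^{n+1}) and (A − iλ_k·I)^{n+1}(P_k x) = 0 for every x ∈ E. -/
open MeasureTheory Complex Filter Topology Metric

namespace SpectralDecomp

variable {G : Type*} [NormedAddCommGroup G] [NormedSpace ℂ G]

/-- The operator `A - c • I`, with the same domain as `A`. -/
def shift (A : G →ₗ.[ℂ] G) (c : ℂ) : G →ₗ.[ℂ] G :=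
  ⟨A.domain, A.toFun - c • A.domain.subtype⟩

namespace ResolventAt

variable {A : G →ₗ.[ℂ] G} {z w : ℂ} {R S : G →L[ℂ] G}

theorem mem_resolventSet (hR : ResolventAt A z R) : z ∈ resolventSet A := ⟨R, hR⟩

/-- The resolvent identity, in the form used for differentiation. -/
theorem apply_sub_apply (hR : ResolventAt A z R) (hS : ResolventAt A w S) (y : G) :
    R y - S y = (w - z) • R (S y) := by
  have h₁ : R (z • S y - A ⟨S y, hS.mem y⟩) = S y := hR.leftInv ⟨S y, hS.mem y⟩
  have h₂ : A ⟨S y, hS.mem y⟩ = w • S y - y := by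
    exact eq_sub_of_add_eq' (sub_eq_iff_eq_add.1 (hS.solves y)).symm
  rw [h₂] at h₁
  simp only [map_sub, map_smul] at h₁
  rw [sub_smul, ← sub_eq_zero, ← sub_eq_zero.2 h₁]
  abel

theorem sub_eq_s11 (hR : ResolventAt A z R) (hS : ResolventAt A w S) :
    R - S = (w - z) • (R ∘L S) := by
  ext y
  simpa using hR.apply_sub_apply hS y

theorem unique_s11 (hR : ResolventAt A z R) (hS : ResolventAt A z S) : R = S := by
  simpa [sub_eq_zero] using hR.sub_eq_s11 hS

theorem apply_eq_of_eq (hR : ResolventAt A z R) {y u : G} (hy : y = R u) :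
    ∃ h : y ∈ A.domain, A ⟨y, h⟩ = z • y - u := by
  subst hy
  exact ⟨hR.mem u, eq_sub_of_add_eq' (sub_eq_iff_eq_add.1 (hR.solves u)).symm⟩

end ResolventAt

section Resolvent

variable {A : G →ₗ.[ℂ] G} {Rres : ℂ → G →L[ℂ] G}

theorem norm_resolvent_le_two_mul (hres : ∀ z ∈ resolventSet A, ResolventAt A z (Rres z))
    {z w : ℂ} (hz : z ∈ resolventSet A) (hw : w ∈ resolventSet A)
    (h : ‖w - z‖ * ‖Rres w‖ ≤ 1 / 2) : ‖Rres z‖ ≤ 2 * ‖Rres w‖ := by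
  have h₁ : ‖Rres z - Rres w‖ ≤ ‖Rres z‖ * (‖w - z‖ * ‖Rres w‖) := by
    rw [(hres z hz).sub_eq_s11 (hres w hw), norm_smul]
    calc _ ≤ ‖w - z‖ * (‖Rres z‖ * ‖Rres w‖) := by
          gcongr; exact ContinuousLinearMap.opNorm_comp_le _ _
      _ = _ := by ring
  have h₂ := norm_sub_norm_le (Rres z) (Rres w)
  nlinarith [norm_nonneg (Rres z)]

theorem continuousOn_resolvent (hres : ∀ z ∈ resolventSet A, ResolventAt A z (Rres z)) :
    ContinuousOn Rres (resolventSet A) := by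
  intro w hw
  rw [ContinuousWithinAt, tendsto_iff_norm_sub_tendsto_zero]
  have hlim : Tendsto (fun z : ℂ => ‖w - z‖) (𝓝[resolventSet A] w) (𝓝 0) := by
    have : Continuous fun z : ℂ => ‖w - z‖ := by fun_prop
    simpa using (this.tendsto w).mono_left nhdsWithin_le_nhds
  have hsmall : ∀ᶠ z in 𝓝[resolventSet A] w, ‖w - z‖ * ‖Rres w‖ ≤ 1 / 2 := by
    have := hlim.mul_const ‖Rres w‖
    rw [zero_mul] at this
    exact this.eventually_le_const (by norm_num)
  have hbound : Tendsto (fun z : ℂ => ‖w - z‖ * (2 * ‖Rres w‖ * ‖Rres w‖))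
      (𝓝[resolventSet A] w) (𝓝 0) := by
    simpa using hlim.mul_const (2 * ‖Rres w‖ * ‖Rres w‖)
  refine squeeze_zero' (.of_forall fun _ => norm_nonneg _) ?_ hbound
  filter_upwards [hsmall, self_mem_nhdsWithin] with z hz hzA
  rw [(hres z hzA).sub_eq_s11 (hres w hw), norm_smul]
  gcongr
  refine (ContinuousLinearMap.opNorm_comp_le _ _).trans ?_
  gcongr
  exact norm_resolvent_le_two_mul hres hzA hw hz

theorem differentiableOn_resolvent (hres : ∀ z ∈ resolventSet A, ResolventAt A z (Rres z)) :
    DifferentiableOn ℂ Rres (resolventSet A) := by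
  intro w hw
  refine HasDerivWithinAt.differentiableWithinAt (f' := -(Rres w ∘L Rres w)) ?_
  rw [hasDerivWithinAt_iff_tendsto_slope]
  have hc : Tendsto (fun z => -(Rres z ∘L Rres w)) (𝓝[resolventSet A \ {w}] w)
      (𝓝 (-(Rres w ∘L Rres w))) :=
    (((continuousOn_resolvent hres w hw).mono Set.sdiff_subset).clm_comp
      continuousWithinAt_const).neg
  refine hc.congr' ?_
  filter_upwards [self_mem_nhdsWithin] with z hz
  have hzw : z - w ≠ 0 := sub_ne_zero.2 hz.2
  rw [slope_def_module, (hres z hz.1).sub_eq_s11 (hres w hw), ← neg_sub z w, neg_smul, smul_neg,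
    smul_smul, inv_mul_cancel₀ hzw, one_smul]

end Resolvent

section Growth

/-- The Laplace transform of a polynomially bounded family of operators blows up polynomially. -/
theorem norm_laplace_le {S : ℝ → G →L[ℂ] G} {n : ℕ} {M B : ℝ} (hM : 0 ≤ M)
    (hS : ∀ t : ℝ, 0 ≤ t → ‖S t‖ ≤ M * (1 + t ^ n)) {z : ℂ} (hz : 0 < z.re) (hzB : z.re ≤ B)
    (x : G) :
    ‖∫ t in Set.Ioi (0 : ℝ), exp (-z * t) • S t x‖ ≤
      2 * M * (B ^ n + n.factorial * 2 ^ n) * ‖x‖ / z.re ^ (n + 1) := by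
  set a := z.re with ha
  have hexp : ∀ t : ℝ, 0 ≤ t → (1 + t ^ n) * Real.exp (-a * t) ≤
      (B ^ n + n.factorial * 2 ^ n) / a ^ n * Real.exp (-(a / 2) * t) := by
    intro t ht
    have h₁ : 1 ≤ B ^ n / a ^ n := by
      rw [one_le_div (by positivity)]
      gcongr
    have h₂ : t ^ n ≤ n.factorial * 2 ^ n / a ^ n * Real.exp (a / 2 * t) := by
      have := Real.pow_div_factorial_le_exp (a / 2 * t) (by positivity) n
      rw [div_le_iff₀ (by positivity)] at this
      calc t ^ n = 2 ^ n / a ^ n * (a / 2 * t) ^ n := by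
            rw [mul_pow, div_pow]; field_simp
        _ ≤ 2 ^ n / a ^ n * (Real.exp (a / 2 * t) * n.factorial) := by gcongr
        _ = _ := by ring
    have h₃ : 1 ≤ Real.exp (a / 2 * t) := Real.one_le_exp (by positivity)
    have h₄ : Real.exp (-(a / 2) * t) = Real.exp (a / 2 * t) * Real.exp (-a * t) := by
      rw [← Real.exp_add]; ring_nf
    rw [h₄, ← mul_assoc]
    gcongr
    have h₅ := mul_le_mul h₁ h₃ zero_le_one (zero_le_one.trans h₁)
    calc 1 + t ^ n ≤ B ^ n / a ^ n * Real.exp (a / 2 * t) +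
          n.factorial * 2 ^ n / a ^ n * Real.exp (a / 2 * t) := by linarith
      _ = _ := by ring
  have hint : IntegrableOn (fun t : ℝ => M * ((B ^ n + n.factorial * 2 ^ n) / a ^ n *
      Real.exp (-(a / 2) * t)) * ‖x‖) (Set.Ioi 0) :=
    (((exp_neg_integrableOn_Ioi 0 (half_pos hz)).const_mul _).const_mul _).mul_const _
  refine (norm_integral_le_of_norm_le hint ?_).trans_eq ?_
  · refine (ae_restrict_mem measurableSet_Ioi).mono fun t ht => ?_
    have ht' : (0 : ℝ) ≤ t := le_of_lt ht
    rw [norm_smul, norm_exp]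
    have hre : (-z * (t : ℂ)).re = -a * t := by simp [ha]
    rw [hre]
    calc Real.exp (-a * t) * ‖S t x‖ ≤ Real.exp (-a * t) * (M * (1 + t ^ n) * ‖x‖) := by
          gcongr; exact (S t).le_of_opNorm_le (hS t ht') x
      _ = M * ((1 + t ^ n) * Real.exp (-a * t)) * ‖x‖ := by ring
      _ ≤ _ := by gcongr ?_ * ?_ * _; exact hexp t ht'
  · rw [integral_mul_const, integral_const_mul, integral_const_mul,
      integral_exp_mul_Ioi (by linarith)]
    simp
    field_simp
    ring

/-- The resolvent of the generator of an integrated group grows at most like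
`|Re z| ^ (-(n + 1))` near the imaginary axis. -/
theorem exists_norm_resolvent_le {A : G →ₗ.[ℂ] G} {Rres : ℂ → G →L[ℂ] G}
    (hres : ∀ z ∈ resolventSet A, ResolventAt A z (Rres z)) {n : ℕ} {M : ℝ} (hM : 0 ≤ M)
    {Sp Sm : ℝ → G →L[ℂ] G} (hgen : Generates A n n M Sp Sm) (B : ℝ) :
    ∃ C : ℝ, 0 ≤ C ∧ ∀ z : ℂ, z.re ≠ 0 → ‖z‖ ≤ B → ‖Rres z‖ ≤ C / |z.re| ^ (n + 1) := by
  obtain ⟨-, -, hp, hm, hR⟩ := hgen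
  refine ⟨|B| ^ n * (2 * M * (|B| ^ n + n.factorial * 2 ^ n)), by positivity, fun z hz hzB => ?_⟩
  have key : ∀ (S : ℝ → G →L[ℂ] G) (_ : ∀ t : ℝ, 0 ≤ t → ‖S t‖ ≤ M * (1 + t ^ n)) (w : ℂ)
      (_ : 0 < w.re) (_ : ‖w‖ ≤ B) (x : G),
      ‖w ^ n • ∫ t in Set.Ioi (0 : ℝ), exp (-w * t) • S t x‖ ≤
        |B| ^ n * (2 * M * (|B| ^ n + n.factorial * 2 ^ n)) / w.re ^ (n + 1) * ‖x‖ := by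
    intro S hS w hw hwB x
    have hwB' : ‖w‖ ≤ |B| := hwB.trans (le_abs_self B)
    rw [norm_smul, norm_pow]
    calc _ ≤ |B| ^ n * (2 * M * (|B| ^ n + n.factorial * 2 ^ n) * ‖x‖ / w.re ^ (n + 1)) := by
          gcongr
          exact norm_laplace_le hM hS hw ((re_le_norm w).trans hwB') x
      _ = _ := by ring
  refine ContinuousLinearMap.opNorm_le_bound _ (by positivity) fun x => ?_
  rcases hz.lt_or_gt with hneg | hpos
  · obtain ⟨R, hR₁, hR₂⟩ := (hR (-z) (by simpa using hneg)).2
    rw [neg_neg] at hR₁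
    rw [(hres z hR₁.mem_resolventSet).unique_s11 hR₁, ← norm_neg, hR₂, abs_of_neg hneg]
    simpa using key Sm hm (-z) (by simpa using hneg) (by simpa using hzB) x
  · obtain ⟨R, hR₁, hR₂⟩ := (hR z hpos).1
    rw [(hres z hR₁.mem_resolventSet).unique_s11 hR₁, hR₂, abs_of_pos hpos]
    exact key Sp hp z hpos hzB x

end Growth

section Moments

theorem coeff_zero_eq_zero_of_norm_sum_le {F : Type*} [NormedAddCommGroup F] [NormedSpace ℝ F]
    {δ C : ℝ} (hδ : 0 < δ) (K m : ℕ) (b : ℕ → F)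
    (h : ∀ t ∈ Set.Ioc 0 δ,
      ‖∑ i ∈ Finset.range (K + 1), (t ^ 2) ^ i • b i‖ ≤ C * t ^ (m + 1)) :
    b 0 = 0 := by
  have hlim : Tendsto (fun t : ℝ => C * t ^ (m + 1)) (𝓝[>] 0) (𝓝 0) := by
    have : Continuous fun t : ℝ => C * t ^ (m + 1) := by fun_prop
    simpa using (this.tendsto 0).mono_left nhdsWithin_le_nhds
  have hsum : Tendsto (fun t : ℝ => ‖∑ i ∈ Finset.range (K + 1), (t ^ 2) ^ i • b i‖)
      (𝓝[>] 0) (𝓝 ‖b 0‖) := by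
    have : Continuous fun t : ℝ => ‖∑ i ∈ Finset.range (K + 1), (t ^ 2) ^ i • b i‖ := by
      fun_prop
    convert (this.tendsto 0).mono_left nhdsWithin_le_nhds using 2
    simp [Finset.sum_range_succ']
  refine norm_le_zero_iff.1 (le_of_tendsto_of_tendsto hsum hlim ?_)
  filter_upwards [Ioc_mem_nhdsGT hδ] with t ht using h t ht

/-- A polynomial of degree at most `K` in `t ^ 2` which is `O(t ^ (2 * K + 1))` as `t → 0` has
vanishing coefficient of order `K`. -/
theorem coeff_eq_zero_of_norm_sum_le {F : Type*} [NormedAddCommGroup F] [NormedSpace ℝ F]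
    {δ C : ℝ} (hδ : 0 < δ) (K : ℕ) (b : ℕ → F)
    (h : ∀ t ∈ Set.Ioc 0 δ,
      ‖∑ i ∈ Finset.range (K + 1), (t ^ 2) ^ i • b i‖ ≤ C * t ^ (2 * K + 1)) :
    b K = 0 := by
  have h0 : b 0 = 0 := coeff_zero_eq_zero_of_norm_sum_le hδ K (2 * K) b h
  induction K generalizing b with
  | zero => exact h0
  | succ K ih =>
    have h' : ∀ t ∈ Set.Ioc 0 δ,
        ‖∑ i ∈ Finset.range (K + 1), (t ^ 2) ^ i • b (i + 1)‖ ≤ C * t ^ (2 * K + 1) := by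
      intro t ht
      have ht0 : 0 < t := ht.1
      have := h t ht
      rw [Finset.sum_range_succ', h0] at this
      simp only [pow_succ (t ^ 2), mul_comm _ (t ^ 2), mul_smul, smul_zero, add_zero,
        ← Finset.smul_sum] at this
      rw [norm_smul, Real.norm_of_nonneg (by positivity)] at this
      refine le_of_mul_le_mul_left (this.trans_eq ?_) (pow_pos ht0 2)
      ring
    exact ih (fun i => b (i + 1)) h' (coeff_zero_eq_zero_of_norm_sum_le hδ K (2 * K) _ h')

theorem _root_.ContinuousLinearMap.circleIntegral_comp_comm {F F' : Type*} [NormedAddCommGroup F]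
    [NormedSpace ℂ F] [CompleteSpace F] [NormedAddCommGroup F'] [NormedSpace ℂ F']
    [CompleteSpace F'] (L : F →L[ℂ] F') {f : ℂ → F} {c : ℂ} {ρ : ℝ}
    (hf : CircleIntegrable f c ρ) : (∮ z in C(c, ρ), L (f z)) = L (∮ z in C(c, ρ), f z) := by
  simp only [circleIntegral, ← L.map_smul]
  exact L.intervalIntegral_comp_comm hf.out

variable {A : G →ₗ.[ℂ] G} {Rres : ℂ → G →L[ℂ] G} {c : ℂ} {ρ : ℝ}

/-- Up to the factor `2πi`, the operator `(A - c) ^ m` composed with the Riesz projection. -/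
noncomputable def moment (Rres : ℂ → G →L[ℂ] G) (c : ℂ) (ρ : ℝ) (m : ℕ) : G →L[ℂ] G :=
  ∮ z in C(c, ρ), (z - c) ^ m • Rres z

theorem continuousOn_pow_smul_resolvent
    (hres : ∀ z ∈ resolventSet A, ResolventAt A z (Rres z)) (m : ℕ) :
    ContinuousOn (fun z => (z - c) ^ m • Rres z) (resolventSet A) :=
  ((continuous_id.sub continuous_const).pow m).continuousOn.smul (continuousOn_resolvent hres)

theorem circleIntegrable_moment (hres : ∀ z ∈ resolventSet A, ResolventAt A z (Rres z))
    (hρ : 0 ≤ ρ) (hs : sphere c ρ ⊆ resolventSet A) (m : ℕ) :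
    CircleIntegrable (fun z => (z - c) ^ m • Rres z) c ρ :=
  ((continuousOn_pow_smul_resolvent hres m).mono hs).circleIntegrable hρ

theorem moment_eq_comp [CompleteSpace G]
    (hres : ∀ z ∈ resolventSet A, ResolventAt A z (Rres z))
    (hρ : 0 ≤ ρ) (hs : sphere c ρ ⊆ resolventSet A) {w : ℂ} (hw : w ∈ resolventSet A) (m : ℕ) :
    moment Rres c ρ m =
      Rres w ∘L ((w - c) • moment Rres c ρ m - moment Rres c ρ (m + 1)) := by
  have hI := circleIntegrable_moment hres hρ hs
  have hpt : ∀ z ∈ sphere c ρ, (z - c) ^ m • Rres z =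
      (z - c) ^ m • Rres w + ContinuousLinearMap.compL ℂ G G G (Rres w)
        ((w - c) • (z - c) ^ m • Rres z - (z - c) ^ (m + 1) • Rres z) := by
    intro z hz
    ext y
    have := (hres w hw).apply_sub_apply (hres z (hs hz)) y
    rw [sub_eq_iff_eq_add] at this
    simp only [ContinuousLinearMap.compL_apply, add_apply,
      smul_apply, ContinuousLinearMap.comp_apply,
      sub_apply, map_sub, map_smul, this]
    module
  have h₀ : (∮ z in C(c, ρ), (z - c) ^ m • Rres w) = 0 := by
    rw [circleIntegral.integral_smul_const]
    have : (∮ z in C(c, ρ), (z - c) ^ m) = 0 :=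
      DiffContOnCl.circleIntegral_eq_zero hρ (Differentiable.diffContOnCl (by fun_prop))
    rw [this, zero_smul]
  have hI₁ : CircleIntegrable (fun z => (w - c) • (z - c) ^ m • Rres z) c ρ :=
    (hI m).fun_continuousOn_smul (g := fun _ => w - c) continuousOn_const
  have hI₂ : CircleIntegrable
      (fun z => (w - c) • (z - c) ^ m • Rres z - (z - c) ^ (m + 1) • Rres z) c ρ :=
    hI₁.sub (hI (m + 1))
  have hcont := fun m => (continuousOn_pow_smul_resolvent (c := c) hres m).mono hs
  have hI₃ : CircleIntegrable (fun z => ContinuousLinearMap.compL ℂ G G G (Rres w)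
      ((w - c) • (z - c) ^ m • Rres z - (z - c) ^ (m + 1) • Rres z)) c ρ :=
    ContinuousOn.circleIntegrable hρ ((ContinuousLinearMap.compL ℂ G G G
      (Rres w)).continuous.comp_continuousOn (((hcont m).const_smul (w - c)).sub (hcont (m + 1))))
  have hI₄ : CircleIntegrable (fun z => (z - c) ^ m • Rres w) c ρ :=
    Continuous.continuousOn (((continuous_id.sub continuous_const).pow m).smul continuous_const)
      |>.circleIntegrable hρ
  conv_lhs => rw [moment]
  rw [circleIntegral.integral_congr hρ hpt, circleIntegral.integral_add hI₄ hI₃, h₀,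
    zero_add, ContinuousLinearMap.circleIntegral_comp_comm _ hI₂,
    circleIntegral.integral_sub hI₁ (hI (m + 1)), circleIntegral.integral_smul]
  rfl

theorem moment_eq_of_le (hres : ∀ z ∈ resolventSet A, ResolventAt A z (Rres z))
    {ρ' : ℝ} (hρ : 0 < ρ) (hρρ' : ρ ≤ ρ') (hs : closedBall c ρ' \ {c} ⊆ resolventSet A) (m : ℕ) :
    moment Rres c ρ' m = moment Rres c ρ m := by
  have hdiff : DifferentiableOn ℂ (fun z => (z - c) ^ m • Rres z) (resolventSet A) :=
    ((differentiable_id.sub_const c).pow m).differentiableOn.smul (differentiableOn_resolvent hres)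
  refine circleIntegral_eq_of_differentiable_on_annulus_off_countable hρ hρρ'
    Set.countable_empty (hdiff.continuousOn.mono fun z hz => hs ⟨hz.1, ?_⟩) fun z hz => ?_
  · rintro rfl
    exact hz.2 (mem_ball_self hρ)
  · refine hdiff.differentiableAt (mem_of_superset
      ((isOpen_ball.sdiff isClosed_closedBall).mem_nhds hz.1) fun u hu => hs ⟨?_, ?_⟩)
    · exact ball_subset_closedBall hu.1
    · rintro rfl
      exact hu.2 (mem_closedBall_self hρ.le)

theorem norm_sq_add_sq_of_mem_sphere {z : ℂ} (hz : z ∈ sphere c ρ) :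
    ‖(ρ : ℂ) ^ 2 + (z - c) ^ 2‖ = 2 * ρ * |(z - c).re| := by
  rw [mem_sphere_iff_norm] at hz
  have h : (ρ : ℂ) ^ 2 + (z - c) ^ 2 = (z - c) * (2 * (z - c).re : ℝ) := by
    rw [← hz, ← conj_mul', ← add_conj]
    ring
  rw [h, norm_mul, hz, norm_real, norm_mul, Real.norm_ofNat, Real.norm_eq_abs]
  ring

/-- If the resolvent is `O(|Re (z - c)| ^ (-K))` around an isolated singularity `c`, then this
singularity is a pole of order at most `K`. -/
theorem moment_eq_zero_of_norm_le (hres : ∀ z ∈ resolventSet A, ResolventAt A z (Rres z))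
    (hρ : 0 < ρ) (hs : closedBall c ρ \ {c} ⊆ resolventSet A) {K : ℕ} (hK : K ≠ 0) {C : ℝ}
    (hC : 0 ≤ C) (hbound : ∀ z ∈ closedBall c ρ, (z - c).re ≠ 0 →
      ‖Rres z‖ ≤ C / |(z - c).re| ^ K) :
    moment Rres c ρ K = 0 := by
  have h := coeff_eq_zero_of_norm_sum_le (F := G →L[ℂ] G) (C := 2 * Real.pi * (2 ^ K * C)) hρ K
    (fun i => (K.choose i : ℂ) • moment Rres c ρ (K + 2 * (K - i))) fun t ht => ?_
  · simpa using h
  have ht0 : 0 < t := ht.1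
  have hst : sphere c t ⊆ resolventSet A := fun z hz =>
    hs ⟨sphere_subset_closedBall.trans (closedBall_subset_closedBall ht.2) hz,
      ne_of_mem_sphere hz ht0.ne'⟩
  have hexpand : ∑ i ∈ Finset.range (K + 1),
      (t ^ 2) ^ i • (K.choose i : ℂ) • moment Rres c ρ (K + 2 * (K - i)) =
      ∮ z in C(c, t), ((z - c) ^ K * ((t : ℂ) ^ 2 + (z - c) ^ 2) ^ K) • Rres z := by
    have hsum : ∀ z : ℂ, ((z - c) ^ K * ((t : ℂ) ^ 2 + (z - c) ^ 2) ^ K) • Rres z =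
        ∑ i ∈ Finset.range (K + 1),
          (((t : ℂ) ^ 2) ^ i * K.choose i) • (z - c) ^ (K + 2 * (K - i)) • Rres z := by
      intro z
      rw [add_pow, Finset.mul_sum, Finset.sum_smul]
      refine Finset.sum_congr rfl fun i _ => ?_
      rw [smul_smul]
      congr 1
      rw [pow_add, pow_mul]
      ring
    simp only [hsum]
    rw [circleIntegral.integral_fun_sum fun i _ =>
      (circleIntegrable_moment hres ht0.le hst _).fun_continuousOn_smul continuousOn_const]
    refine Finset.sum_congr rfl fun i _ => ?_
    rw [circleIntegral.integral_smul, moment_eq_of_le hres ht0 ht.2 hs, mul_smul,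
      ← coe_smul ((t ^ 2) ^ i)]
    push_cast
    rfl
  rw [hexpand]
  refine (circleIntegral.norm_integral_le_of_norm_le_const (C := t ^ K * ((2 * t) ^ K * C))
    ht0.le fun z hz => ?_).trans_eq (by ring)
  have hz' : ‖z - c‖ = t := mem_sphere_iff_norm.1 hz
  rw [norm_smul, norm_mul, norm_pow, norm_pow, hz', norm_sq_add_sq_of_mem_sphere hz, mul_assoc]
  refine mul_le_mul_of_nonneg_left ?_ (pow_nonneg ht0.le K)
  by_cases hre : (z - c).re = 0
  · simp only [hre, abs_zero, mul_zero, zero_pow hK, zero_mul]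
    positivity
  · have hre' : 0 < |(z - c).re| := abs_pos.2 hre
    calc (2 * t * |(z - c).re|) ^ K * ‖Rres z‖
        ≤ (2 * t * |(z - c).re|) ^ K * (C / |(z - c).re| ^ K) := by
          gcongr
          exact hbound z (sphere_subset_closedBall.trans (closedBall_subset_closedBall ht.2) hz) hre
      _ = (2 * t) ^ K * C := by rw [mul_pow]; field_simp

end Moments

section Powers

variable {A : G →ₗ.[ℂ] G}

theorem inDomPow_of_mem {V : Submodule ℂ G}
    (hV : ∀ y ∈ V, ∃ h : y ∈ A.domain, A ⟨y, h⟩ ∈ V) (j : ℕ) {y : G} (hy : y ∈ V) :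
    InDomPow A j y := by
  induction j generalizing y with
  | zero => trivial
  | succ j ih =>
    obtain ⟨h, hA⟩ := hV y hy
    exact ⟨h, ih hA⟩

theorem powApply_eq_of_chain {y : ℕ → G} (hy : ∀ m, ∃ h : y m ∈ A.domain, A ⟨y m, h⟩ = y (m + 1))
    (j m : ℕ) {u : G} (hu : u = y m) : ∃ h : InDomPow A j u, powApply A j u h = y (m + j) := by
  induction j generalizing m u with
  | zero => exact ⟨trivial, hu⟩
  | succ j ih =>
    subst hu
    obtain ⟨h, hA⟩ := hy m
    obtain ⟨h', hA'⟩ := ih (m + 1) hA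
    refine ⟨⟨h, h'⟩, ?_⟩
    rw [show m + (j + 1) = m + 1 + j by ring, ← hA']
    rfl

theorem inDomPow_of_shift_chain {c : ℂ} {y : ℕ → G}
    (hy : ∀ m, ∃ h : y m ∈ A.domain, A ⟨y m, h⟩ = c • y m + y (m + 1)) (j m : ℕ) :
    InDomPow A j (y m) := by
  refine inDomPow_of_mem (V := Submodule.span ℂ (Set.range y)) (fun u hu => ?_) j
    (Submodule.subset_span ⟨m, rfl⟩)
  induction hu using Submodule.span_induction with
  | mem u hu =>
    obtain ⟨m, rfl⟩ := hu
    obtain ⟨h, hA⟩ := hy m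
    exact ⟨h, hA ▸ add_mem (Submodule.smul_mem _ _ (Submodule.subset_span ⟨m, rfl⟩))
      (Submodule.subset_span ⟨m + 1, rfl⟩)⟩
  | zero =>
    refine ⟨A.domain.zero_mem, ?_⟩
    exact (congrArg (· ∈ Submodule.span ℂ (Set.range y)) A.map_zero).mpr (zero_mem _)
  | add u v _ _ hu hv =>
    obtain ⟨h₁, h₁'⟩ := hu
    obtain ⟨h₂, h₂'⟩ := hv
    refine ⟨add_mem h₁ h₂, ?_⟩
    have := A.map_add ⟨u, h₁⟩ ⟨v, h₂⟩
    exact (congrArg (· ∈ Submodule.span ℂ (Set.range y)) this).mpr (add_mem h₁' h₂')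
  | smul a u _ hu =>
    obtain ⟨h₁, h₁'⟩ := hu
    refine ⟨Submodule.smul_mem _ a h₁, ?_⟩
    have := A.map_smul a ⟨u, h₁⟩
    exact (congrArg (· ∈ Submodule.span ℂ (Set.range y)) this).mpr (Submodule.smul_mem _ a h₁')

end Powers

/-- Nilpotency on spectral subspaces in the integrated group case: if `A`
generates an `n`-times integrated group bounded by `M (1 + |t| ^ n)` with
discrete spectrum `σ(A) = {iλ_k}` as in the spectral assumption, then for every
`k` one has `P_k(E) ⊆ D(A^(n+1))` and `(A - iλ_k I)^(n+1) P_k x = 0` for all `x`. -/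
theorem nilpotent_on_spectral_subspace
    {E : Type*} [NormedAddCommGroup E] [NormedSpace ℂ E] [CompleteSpace E]
    (A : E →ₗ.[ℂ] E)
    (hAclosed : IsClosed (A.graph : Set (E × E)))
    (hAdense : Dense (A.domain : Set E))
    (n : ℕ) (M : ℝ) (hM : 0 < M)
    (Sp Sm : ℝ → E →L[ℂ] E) (hgen : Generates A n n M Sp Sm)
    (Rres : ℂ → E →L[ℂ] E)
    (hres : ∀ z ∈ resolventSet A, ResolventAt A z (Rres z))
    (lam : ℤ → ℝ)
    (hmono : ∀ j k : ℤ, j ≠ 0 → k ≠ 0 → j < k → lam j < lam k)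
    (hpos : ∀ k : ℤ, 0 < k → 0 < lam k)
    (hneg : ∀ k : ℤ, k < 0 → lam k < 0)
    (hspec : spectrumSet A = {z : ℂ | ∃ k : ℤ, k ≠ 0 ∧ z = Complex.I * (lam k : ℂ)})
    (r : ℤ → ℝ) (hrpos : ∀ k : ℤ, k ≠ 0 → 0 < r k)
    (hrsep : ∀ k : ℤ, k ≠ 0 → ∀ z ∈ spectrumSet A,
      z ∈ Metric.closedBall (Complex.I * (lam k : ℂ)) (r k) → z = Complex.I * (lam k : ℂ))
    (k : ℤ) (hk : k ≠ 0) (x : E) :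
    InDomPow A (n + 1) (rieszProj Rres (Complex.I * (lam k : ℂ)) (r k) x) ∧
    ∃ hmem : InDomPow (shift A (Complex.I * (lam k : ℂ))) (n + 1)
        (rieszProj Rres (Complex.I * (lam k : ℂ)) (r k) x),
      powApply (shift A (Complex.I * (lam k : ℂ))) (n + 1)
        (rieszProj Rres (Complex.I * (lam k : ℂ)) (r k) x) hmem = 0 := by
  set c : ℂ := Complex.I * (lam k : ℂ) with hc
  have hr := hrpos k hk
  have hs : closedBall c (r k) \ {c} ⊆ resolventSet A := fun z hz => by
    by_contra hz'
    exact hz.2 (hrsep k hk z hz' hz.1)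
  have hsphere : sphere c (r k) ⊆ resolventSet A := fun z hz =>
    hs ⟨sphere_subset_closedBall hz, ne_of_mem_sphere hz hr.ne'⟩
  obtain ⟨C, hC, hbound⟩ := exists_norm_resolvent_le hres hM.le hgen (‖c‖ + r k)
  have hzero : moment Rres c (r k) (n + 1) = 0 := by
    refine moment_eq_zero_of_norm_le hres hr hs n.succ_ne_zero hC fun z hz hre => ?_
    have hcre : c.re = 0 := by simp [hc]
    rw [sub_re, hcre, sub_zero] at hre ⊢
    refine hbound z hre ?_
    have := norm_le_norm_add_norm_sub' z c
    exact this.trans (by gcongr; exact mem_closedBall_iff_norm.1 hz)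
  obtain ⟨w, hw⟩ : (resolventSet A).Nonempty := ⟨c + r k, hsphere (by simp [abs_of_pos hr])⟩
  let y : ℕ → E := fun m => (2 * Real.pi * Complex.I)⁻¹ • moment Rres c (r k) m x
  have hy : ∀ m, ∃ h : y m ∈ A.domain, A ⟨y m, h⟩ = c • y m + y (m + 1) := by
    intro m
    have hym : y m = Rres w ((w - c) • y m - y (m + 1)) := by
      have := congrArg (fun T : E →L[ℂ] E => (2 * Real.pi * Complex.I)⁻¹ • T x)
        (moment_eq_comp hres hr.le hsphere hw m)
      simpa [y, smul_sub, smul_comm (w - c)] using this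
    obtain ⟨h, hA⟩ := (hres w hw).apply_eq_of_eq hym
    exact ⟨h, hA.trans (by module)⟩
  have hy_shift : ∀ m, ∃ h : y m ∈ (shift A c).domain, shift A c ⟨y m, h⟩ = y (m + 1) := by
    intro m
    obtain ⟨h, hA⟩ := hy m
    exact ⟨h, sub_eq_iff_eq_add'.2 hA⟩
  have hP : rieszProj Rres c (r k) x = y 0 := by simp [rieszProj, y, moment]
  refine ⟨hP ▸ inDomPow_of_shift_chain hy (n + 1) 0, ?_⟩
  obtain ⟨h, hpow⟩ := powApply_eq_of_chain hy_shift (n + 1) 0 hP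
  exact ⟨h, hpow.trans (by simp [y, hzero])⟩

end SpectralDecomp
end
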